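/- Let G = (V,E) be a finite undirected graph with m ≥ 1 edges, φ ∈ (0,1), and let h be a positive integer with h ≥ 10·ln(2m). Let Δ : V → ℝ_{≥0} satisfy ∑_v Δ(v) ≤ 3m/2, and let (Δ, f, l) be a valid state for G (with sink capacities deg_G, edge capacities 2/φ, and labels in {0,…,h}). Then there exist f', l' : V → {0,…,h} and a set S ⊆ V such that (Δ, f', l') is a valid solution for G, and either: (1) S = ∅ and f' is a feasible routing for Δ; or (2) S ≠ ∅, S = {u ∈ V : l'(u) ≥ k} for some k ≥ 1, and the number of edges {u,v} of G with u ∈ S, v ∈ V∖S and f'(u,v) < 2/φ is at most 5·vol_G(S)·ln(2m)/h. -/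

import Mathlib

/-!
STATEMENT 9 (Lemma 3.4 — Unit-Flow key lemma):
Given `G` with `m ≥ 1` edges, `φ ∈ (0,1)`, a positive integer `h ≥ 10·ln(2m)`,
a source function `Δ` with `∑_v Δ(v) ≤ 3m/2`, and a `G`-valid state `(Δ, f, l)`,
there exist `(Δ, f', l')` a `G`-valid solution and `S ⊆ V` with either
(1) `S = ∅` and `f'` feasible for `Δ`, or
(2) `S ≠ ∅` is a level cut `S = {u : l'(u) ≥ k}`, `k ≥ 1`, and the number of
edges `{u,v}` with `u ∈ S`, `v ∈ V∖S`, `f'(u,v) < 2/φ` is at most `5·vol(S)·ln(2m)/h`.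
-/

open Finset

noncomputable section
open scoped Classical

/-- `vol_G(S) = ∑_{v ∈ S} deg_G(v)`. -/
def vol {V : Type*} [Fintype V] [DecidableEq V] (G : SimpleGraph V) (S : Finset V) : ℕ :=
  ∑ v ∈ S, G.degree v

/-- `f` is a pre-flow on `G[A]` for source `Δ`: skew-symmetric, supported on the edges of
`G[A]`, obeying edge capacity `2/φ`, and routing away from each node at most its
initial mass. -/
def IsPreflow {V : Type*} [Fintype V] [DecidableEq V] (G : SimpleGraph V) (φ : ℝ)
    (A : Finset V) (Δ : V → ℝ) (f : V → V → ℝ) : Prop :=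
  (∀ u v, f u v = - f v u) ∧
  (∀ u v, ¬(u ∈ A ∧ v ∈ A ∧ G.Adj u v) → f u v = 0) ∧
  (∀ u ∈ A, ∀ v ∈ A, G.Adj u v → |f u v| ≤ 2 / φ) ∧
  (∀ v ∈ A, ∑ u ∈ A, f v u ≤ Δ v)

/-- `f(v) = Δ(v) + ∑_u f(u,v)`, the amount of mass ending at `v` after the routing `f`. -/
def mass {V : Type*} [Fintype V] [DecidableEq V] (G : SimpleGraph V) (A : Finset V)
    (Δ : V → ℝ) (f : V → V → ℝ) (v : V) : ℝ :=
  Δ v + ∑ u ∈ A, f u v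

/-- `(Δ, f, l)` is a valid state for `G{A}` (sink capacities `deg_G`, edge capacities
`2/φ`, labels in `{0,…,h}`). -/
def ValidState {V : Type*} [Fintype V] [DecidableEq V] (G : SimpleGraph V) (φ : ℝ) (h : ℕ)
    (A : Finset V) (Δ : V → ℝ) (f : V → V → ℝ) (l : V → ℕ) : Prop :=
  IsPreflow G φ A Δ f ∧
  (∀ v ∈ A, l v ≤ h) ∧
  -- (i) if l(u) > l(v) + 1 for an edge (u,v), then (u,v) is saturated
  (∀ u ∈ A, ∀ v ∈ A, G.Adj u v → l v + 1 < l u → f u v = 2 / φ) ∧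
  -- (ii) if l(u) ≥ 1, then u's sink is saturated
  (∀ u ∈ A, 1 ≤ l u → (G.degree u : ℝ) ≤ mass G A Δ f u)

/-- `(Δ, f, l)` is a valid solution for `G{A}`: a valid state such that additionally
(iii) nodes of label `< h` carry no excess mass. -/
def ValidSolution {V : Type*} [Fintype V] [DecidableEq V] (G : SimpleGraph V) (φ : ℝ)
    (h : ℕ) (A : Finset V) (Δ : V → ℝ) (f : V → V → ℝ) (l : V → ℕ) : Prop :=
  ValidState G φ h A Δ f l ∧
  (∀ u ∈ A, l u < h → mass G A Δ f u ≤ (G.degree u : ℝ))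

/-- The set of flows that are valid for fixed labels is compact. -/
theorem validState_compact {V : Type*} [Fintype V] [DecidableEq V] (G : SimpleGraph V) (φ : ℝ)
    (hφ : 0 < φ) (h : ℕ) (Δ : V → ℝ) (l : V → ℕ) :
    IsCompact {f : V → V → ℝ | ValidState G φ h Finset.univ Δ f l} := by
  have hK : IsCompact (Set.pi Set.univ (fun _ : V => Set.pi Set.univ
      (fun _ : V => Set.Icc (-(2 / φ)) (2 / φ)))) :=
    isCompact_univ_pi (fun _ => isCompact_univ_pi (fun _ => isCompact_Icc))
  refine hK.of_isClosed_subset ?_ ?_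
  · unfold ValidState IsPreflow mass
    simp only [Set.ofPred_and, Set.ofPred_forall]
    refine IsClosed.inter (IsClosed.inter ?_ (IsClosed.inter ?_ (IsClosed.inter ?_ ?_)))
      (IsClosed.inter ?_ (IsClosed.inter ?_ ?_))
    · exact isClosed_iInter fun u => isClosed_iInter fun v =>
        isClosed_eq (by fun_prop) (by fun_prop)
    · exact isClosed_iInter fun u => isClosed_iInter fun v => isClosed_iInter fun _ =>
        isClosed_eq (by fun_prop) (by fun_prop)
    · exact isClosed_iInter fun u => isClosed_iInter fun _ => isClosed_iInter fun v =>
        isClosed_iInter fun _ => isClosed_iInter fun _ =>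
        isClosed_le (by fun_prop) (by fun_prop)
    · exact isClosed_iInter fun u => isClosed_iInter fun _ =>
        isClosed_le (by fun_prop) (by fun_prop)
    · exact isClosed_iInter fun u => isClosed_iInter fun _ => isClosed_const
    · exact isClosed_iInter fun u => isClosed_iInter fun _ => isClosed_iInter fun v =>
        isClosed_iInter fun _ => isClosed_iInter fun _ => isClosed_iInter fun _ =>
        isClosed_eq (by fun_prop) (by fun_prop)
    · exact isClosed_iInter fun u => isClosed_iInter fun _ => isClosed_iInter fun _ =>
        isClosed_le (by fun_prop) (by fun_prop)
  · rintro f ⟨⟨-, h2, h3, -⟩, -⟩ u - v -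
    rw [Set.mem_Icc, ← abs_le]
    by_cases ha : G.Adj u v
    · exact h3 u (mem_univ _) v (mem_univ _) ha
    · rw [h2 u v (by tauto)]
      simp; positivity

/-- Pushing `ε` units along `(a, b)`. -/
def pushFlow {V : Type*} [DecidableEq V] (f : V → V → ℝ) (a b : V) (ε : ℝ) : V → V → ℝ :=
  fun u v => f u v + (if u = a ∧ v = b then ε else 0) - (if u = b ∧ v = a then ε else 0)

theorem mass_push {V : Type*} [Fintype V] [DecidableEq V] (G : SimpleGraph V) (Δ : V → ℝ)
    (f : V → V → ℝ) (a b : V) (ε : ℝ) (v : V) :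
    mass G Finset.univ Δ (pushFlow f a b ε) v = mass G Finset.univ Δ f v +
      (if v = b then ε else 0) - (if v = a then ε else 0) := by
  unfold mass pushFlow
  rw [Finset.sum_sub_distrib, Finset.sum_add_distrib]
  have h1 : ∀ x y : V, ∑ u : V, (if u = x ∧ v = y then ε else 0) = if v = y then ε else 0 := by
    intro x y
    by_cases h : v = y <;> simp [h]
  rw [h1, h1]
  ring

theorem exists_solution {V : Type*} [Fintype V] [DecidableEq V] (G : SimpleGraph V) (φ : ℝ)
    (hφ : 0 < φ) (h : ℕ) (Δ : V → ℝ) (f : V → V → ℝ) (l : V → ℕ)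
    (hvalid : ValidState G φ h Finset.univ Δ f l) :
    ∃ f' l', ValidSolution G φ h Finset.univ Δ f' l' := by
  obtain ⟨l', ⟨f₀, hf₀⟩, hmax⟩ : ∃ l' : V → ℕ, (∃ f', ValidState G φ h Finset.univ Δ f' l') ∧
      ∀ l'' f'', ValidState G φ h Finset.univ Δ f'' l'' → ∑ v, l'' v ≤ ∑ v, l' v := by
    let P : ℕ → Prop := fun n => ∃ l' f', ValidState G φ h Finset.univ Δ f' l' ∧ ∑ v, l' v = n
    have hb : ∀ l' f', ValidState G φ h Finset.univ Δ f' l' → ∑ v, l' v ≤ ∑ _v : V, h :=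
      fun l' f' hv => Finset.sum_le_sum fun v hv' => hv.2.1 v hv'
    have hP : P (Nat.findGreatest P (∑ _v : V, h)) :=
      Nat.findGreatest_spec (P := P) (hb l f hvalid) ⟨l, f, hvalid, rfl⟩
    obtain ⟨l', f', h1, h2⟩ := hP
    refine ⟨l', ⟨f', h1⟩, fun l'' f'' h3 => ?_⟩
    rw [h2]
    exact Nat.le_findGreatest (hb l'' f'' h3) ⟨l'', f'', h3, rfl⟩
  obtain ⟨f', hf', hmin⟩ := (validState_compact G φ hφ h Δ l').exists_isMinOn ⟨f₀, hf₀⟩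
    (f := fun f => ∑ v, mass G Finset.univ Δ f v * (l' v : ℝ))
    (by unfold mass; fun_prop)
  refine ⟨f', l', hf', ?_⟩
  obtain ⟨⟨p1, p2, p3, p4⟩, q1, q2, q3⟩ := hf'
  by_contra! hcon
  obtain ⟨a, -, hah, hexc⟩ := hcon
  by_cases hpush : ∃ b, G.Adj a b ∧ l' b + 1 = l' a ∧ f' a b < 2 / φ
  · obtain ⟨b, hab, hl, hcap⟩ := hpush
    have hne : a ≠ b := hab.ne
    obtain ⟨ε, hε0, hε1, hε2⟩ : ∃ ε > 0, ε ≤ mass G Finset.univ Δ f' a - G.degree a ∧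
        ε ≤ 2 / φ - f' a b :=
      ⟨min (mass G Finset.univ Δ f' a - G.degree a) (2 / φ - f' a b),
        lt_min (by linarith) (by linarith), min_le_left _ _, min_le_right _ _⟩
    have hmass : ∀ v, mass G Finset.univ Δ (pushFlow f' a b ε) v = _ :=
      mass_push G Δ f' a b ε
    have hskew : ∀ u v, pushFlow f' a b ε u v = - pushFlow f' a b ε v u := by
      intro u v
      unfold pushFlow
      rw [p1 u v]
      simp only [and_comm (a := v = a), and_comm (a := v = b)]
      ring
    have hnet : ∀ g : V → V → ℝ, (∀ u v, g u v = - g v u) → ∀ v,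
        ∑ u, g v u = Δ v - mass G Finset.univ Δ g v := by
      intro g hg v
      unfold mass
      rw [Finset.sum_congr rfl (fun u _ => hg v u), Finset.sum_neg_distrib]
      ring
    have hdeg : (0 : ℝ) ≤ G.degree a := Nat.cast_nonneg _
    have hval : ValidState G φ h Finset.univ Δ (pushFlow f' a b ε) l' := by
      refine ⟨⟨hskew, ?_, ?_, ?_⟩, q1, ?_, ?_⟩
      · intro u v huv
        have hnadj : ¬ G.Adj u v := by simpa using huv
        have e1 : ¬ (u = a ∧ v = b) := by rintro ⟨rfl, rfl⟩; exact hnadj hab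
        have e2 : ¬ (u = b ∧ v = a) := by rintro ⟨rfl, rfl⟩; exact hnadj hab.symm
        unfold pushFlow
        rw [p2 u v huv, if_neg e1, if_neg e2]; ring
      · intro u _ v _ huv
        have h0 := abs_le.1 (p3 u (mem_univ _) v (mem_univ _) huv)
        unfold pushFlow
        by_cases e1 : u = a ∧ v = b
        · obtain ⟨rfl, rfl⟩ := e1
          rw [if_pos ⟨rfl, rfl⟩, if_neg (fun h => hne h.1), abs_le]
          constructor <;> linarith [h0.1, h0.2]
        · by_cases e2 : u = b ∧ v = a
          · obtain ⟨rfl, rfl⟩ := e2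
            rw [if_neg e1, if_pos ⟨rfl, rfl⟩, abs_le]
            have := p1 u v
            constructor <;> linarith [h0.1, h0.2]
          · rw [if_neg e1, if_neg e2, abs_le]
            constructor <;> linarith [h0.1, h0.2]
      · intro v _
        have h4 := p4 v (mem_univ _)
        rw [hnet _ hskew, hmass]
        rw [hnet _ p1] at h4
        by_cases ha : v = a
        · subst ha
          rw [if_neg hne, if_pos rfl]; linarith
        · rw [if_neg ha]
          split_ifs <;> linarith
      · intro u _ v _ huv hluv
        have e1 : ¬ (u = a ∧ v = b) := by rintro ⟨rfl, rfl⟩; omega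
        have e2 : ¬ (u = b ∧ v = a) := by rintro ⟨rfl, rfl⟩; omega
        unfold pushFlow
        rw [q2 u (mem_univ _) v (mem_univ _) huv hluv, if_neg e1, if_neg e2]; ring
      · intro v _ hv
        have h4 := q3 v (mem_univ _) hv
        rw [hmass]
        by_cases ha : v = a
        · subst ha
          rw [if_neg hne, if_pos rfl]; linarith
        · rw [if_neg ha]
          split_ifs <;> linarith
    have hle : ∑ v, mass G Finset.univ Δ f' v * (l' v : ℝ) ≤
        ∑ v, mass G Finset.univ Δ (pushFlow f' a b ε) v * (l' v : ℝ) := hmin hval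
    have heq : ∑ v, mass G Finset.univ Δ (pushFlow f' a b ε) v * (l' v : ℝ) =
        ∑ v, mass G Finset.univ Δ f' v * (l' v : ℝ) + ε * l' b - ε * l' a := by
      simp only [hmass, sub_mul, add_mul, Finset.sum_sub_distrib, Finset.sum_add_distrib,
        ite_mul, zero_mul, Finset.sum_ite_eq', Finset.mem_univ, if_true]
    have hl' : (l' a : ℝ) = l' b + 1 := by rw [← hl]; push_cast; ring
    rw [heq, hl'] at hle
    linarith
  · push Not at hpush
    have hval : ValidState G φ h Finset.univ Δ f' (Function.update l' a (l' a + 1)) := by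
      refine ⟨⟨p1, p2, p3, p4⟩, ?_, ?_, ?_⟩
      · intro v _
        by_cases hv : v = a
        · subst hv; simp; omega
        · simp [hv]; exact q1 v (mem_univ _)
      · intro u _ v _ huv hlt
        have hcap := (abs_le.1 (p3 u (mem_univ _) v (mem_univ _) huv)).2
        by_cases hu : u = a
        · subst hu
          have hv : v ≠ u := huv.ne.symm
          simp [hv] at hlt
          by_cases he : l' v + 1 = l' u
          · exact le_antisymm hcap (hpush v huv he)
          · exact q2 u (mem_univ _) v (mem_univ _) huv (by omega)
        · by_cases hv : v = a
          · subst hv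
            simp [hu] at hlt
            exact q2 u (mem_univ _) v (mem_univ _) huv (by omega)
          · simp [hu, hv] at hlt
            exact q2 u (mem_univ _) v (mem_univ _) huv (by omega)
      · intro v _ hv1
        by_cases hv : v = a
        · subst hv; exact hexc.le
        · simp [hv] at hv1
          exact q3 v (mem_univ _) hv1
    have := hmax _ _ hval
    rw [Finset.sum_update_of_mem (mem_univ _)] at this
    rw [← Finset.add_sum_erase _ _ (mem_univ a), Finset.sdiff_singleton_eq_erase] at this
    omega

theorem count_le_right {V : Type*} [Fintype V] [DecidableEq V] (G : SimpleGraph V)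
    (P : Finset (V × V)) (T : Finset V) (hP : ∀ p ∈ P, p.2 ∈ T ∧ G.Adj p.1 p.2) :
    P.card ≤ vol G T := by
  have hsub : P.card ≤ (T.sigma fun v => G.neighborFinset v).card := by
    refine Finset.card_le_card_of_injOn (fun p => (⟨p.2, p.1⟩ : Σ _ : V, V)) ?_ ?_
    · intro p hp
      have := hP p hp
      simp [this.1, this.2.symm]
    · rintro ⟨a, b⟩ _ ⟨c, d⟩ _ h
      simp at h
      simp [h.1, h.2]
  rw [Finset.card_sigma] at hsub
  simpa [vol] using hsub

theorem count_le_left {V : Type*} [Fintype V] [DecidableEq V] (G : SimpleGraph V)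
    (P : Finset (V × V)) (T : Finset V) (hP : ∀ p ∈ P, p.1 ∈ T ∧ G.Adj p.1 p.2) :
    P.card ≤ vol G T := by
  have hsub : P.card ≤ (T.sigma fun v => G.neighborFinset v).card := by
    refine Finset.card_le_card_of_injOn (fun p => (⟨p.1, p.2⟩ : Σ _ : V, V)) ?_ ?_
    · intro p hp
      have := hP p hp
      simp [this.1, this.2]
    · rintro ⟨a, b⟩ _ ⟨c, d⟩ _ h
      simp at h
      simp [h.1, h.2]
  rw [Finset.card_sigma] at hsub
  simpa [vol] using hsub

theorem unit_flow_key
    {V : Type*} [Fintype V] [DecidableEq V] (G : SimpleGraph V) (φ : ℝ) (h : ℕ)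
    (Δ : V → ℝ) (f : V → V → ℝ) (l : V → ℕ)
    (hm : 1 ≤ G.edgeFinset.card) (hφ0 : 0 < φ) (hφ1 : φ < 1)
    (hh : 0 < h) (hh' : 10 * Real.log (2 * G.edgeFinset.card) ≤ (h : ℝ))
    (hΔ0 : ∀ v, 0 ≤ Δ v)
    (hΔ : ∑ v, Δ v ≤ 3 * (G.edgeFinset.card : ℝ) / 2)
    (hvalid : ValidState G φ h Finset.univ Δ f l) :
    ∃ (f' : V → V → ℝ) (l' : V → ℕ) (S : Finset V),
      ValidSolution G φ h Finset.univ Δ f' l' ∧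
      -- case (1): S = ∅ and f' is a feasible routing for Δ
      ((S = ∅ ∧ ∀ v, mass G Finset.univ Δ f' v ≤ (G.degree v : ℝ)) ∨
      -- case (2): S is a nonempty level cut with few unsaturated boundary edges
       (S.Nonempty ∧
        (∃ k : ℕ, 1 ≤ k ∧ S = Finset.univ.filter fun u => k ≤ l' u) ∧
        (((S ×ˢ Sᶜ).filter fun p => G.Adj p.1 p.2 ∧ f' p.1 p.2 < 2 / φ).card : ℝ) ≤
          5 * (vol G S : ℝ) * Real.log (2 * G.edgeFinset.card) / h)) := by
  
  obtain ⟨f', l', hsol⟩ := exists_solution G φ hφ0 h Δ f l hvalid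
  by_cases hfeas : ∀ v, mass G Finset.univ Δ f' v ≤ (G.degree v : ℝ)
  · exact ⟨f', l', ∅, hsol, Or.inl ⟨rfl, hfeas⟩⟩
  push Not at hfeas
  obtain ⟨w, hw⟩ := hfeas
  have hlw : h ≤ l' w := by
    by_contra! hlt
    exact absurd (hsol.2 w (mem_univ _) hlt) (not_le.2 hw)
  by_contra! hcon
  set m : ℕ := G.edgeFinset.card with hmdef
  set L : ℝ := Real.log (2 * (m : ℝ)) with hL
  have hm1 : (1 : ℝ) ≤ m := by exact_mod_cast hm
  have hhR : (0 : ℝ) < h := by exact_mod_cast hh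
  have hLpos : 0 < L := Real.log_pos (by linarith)
  have key : ∀ k, 1 ≤ k → k ≤ h →
      5 * (vol G (Finset.univ.filter fun u => k ≤ l' u) : ℝ) * L / h <
      ((((Finset.univ.filter fun u => k ≤ l' u) ×ˢ (Finset.univ.filter fun u => k ≤ l' u)ᶜ).filter
        fun p => G.Adj p.1 p.2 ∧ f' p.1 p.2 < 2 / φ).card : ℝ) := by
    intro k hk hkh
    exact (hcon f' l' (Finset.univ.filter fun u => k ≤ l' u) hsol).2
      ⟨w, by simp; omega⟩ ⟨k, hk, rfl⟩
  have step : ∀ k, 1 ≤ k → k ≤ h →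
      (1 + 5 * L / h) * (vol G (Finset.univ.filter fun u => k ≤ l' u) : ℝ) ≤
        (vol G (Finset.univ.filter fun u => k - 1 ≤ l' u) : ℝ) := by
    intro k hk hkh
    have h1 := key k hk hkh
    have h2 := count_le_right G (((Finset.univ.filter fun u => k ≤ l' u) ×ˢ
        (Finset.univ.filter fun u => k ≤ l' u)ᶜ).filter
        fun p => G.Adj p.1 p.2 ∧ f' p.1 p.2 < 2 / φ)
        (Finset.univ.filter fun u => l' u = k - 1) (by
      rintro ⟨u, v⟩ hp
      simp at hp
      obtain ⟨⟨hu, hv⟩, hadj, hlt⟩ := hp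
      refine ⟨?_, hadj⟩
      simp
      have : ¬ (l' v + 1 < l' u) := fun hc =>
        absurd (hsol.1.2.2.1 u (mem_univ _) v (mem_univ _) hadj hc) hlt.ne
      omega)
    have h3 : vol G (Finset.univ.filter fun u => k - 1 ≤ l' u) =
        vol G (Finset.univ.filter fun u => k ≤ l' u) +
        vol G (Finset.univ.filter fun u => l' u = k - 1) := by
      unfold vol
      rw [← Finset.sum_union]
      · congr 1
        ext u
        simp
        omega
      · rw [Finset.disjoint_filter]
        intro u _ hu
        omega
    rw [h3]
    have h4 : ((((Finset.univ.filter fun u => k ≤ l' u) ×ˢ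
        (Finset.univ.filter fun u => k ≤ l' u)ᶜ).filter
        fun p => G.Adj p.1 p.2 ∧ f' p.1 p.2 < 2 / φ).card : ℝ) ≤
        (vol G (Finset.univ.filter fun u => l' u = k - 1) : ℝ) := by exact_mod_cast h2
    push_cast
    have h5 : (1 + 5 * L / h) * (vol G (Finset.univ.filter fun u => k ≤ l' u) : ℝ) =
        (vol G (Finset.univ.filter fun u => k ≤ l' u) : ℝ) +
        5 * (vol G (Finset.univ.filter fun u => k ≤ l' u) : ℝ) * L / h := by ring
    linarith
  have hx0 : 0 < 5 * L / h := by positivity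
  have hx1 : 5 * L / h ≤ 1 / 2 := by
    rw [div_le_iff₀ hhR]; linarith
  have iter : ∀ j, j ≤ h →
      (1 + 5 * L / h) ^ j * (vol G (Finset.univ.filter fun u => h ≤ l' u) : ℝ) ≤
        (vol G (Finset.univ.filter fun u => h - j ≤ l' u) : ℝ) := by
    intro j
    induction j with
    | zero => intro _; simp
    | succ j ih =>
      intro hj
      have h1 := ih (by omega)
      have h2 := step (h - j) (by omega) (by omega)
      rw [show h - (j + 1) = h - j - 1 by omega, pow_succ']
      refine le_trans ?_ h2
      rw [mul_assoc]
      exact mul_le_mul_of_nonneg_left h1 (by linarith)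
  have hvh : (1 : ℝ) ≤ vol G (Finset.univ.filter fun u => h ≤ l' u) := by
    have h1 := key h hh le_rfl
    have h2 := count_le_left G (((Finset.univ.filter fun u => h ≤ l' u) ×ˢ
        (Finset.univ.filter fun u => h ≤ l' u)ᶜ).filter
        fun p => G.Adj p.1 p.2 ∧ f' p.1 p.2 < 2 / φ)
        (Finset.univ.filter fun u => h ≤ l' u) (by
      rintro ⟨u, v⟩ hp
      simp at hp
      simp [hp.1.1, hp.2.1])
    have h3 : 0 ≤ 5 * (vol G (Finset.univ.filter fun u => h ≤ l' u) : ℝ) * L / h := by positivity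
    have h4 := Nat.cast_pos.1 (lt_of_le_of_lt h3 h1)
    exact_mod_cast lt_of_lt_of_le h4 h2
  have htot : (vol G (Finset.univ.filter fun u => h - h ≤ l' u) : ℝ) = 2 * m := by
    have : vol G (Finset.univ.filter fun u => h - h ≤ l' u) = 2 * m := by
      unfold vol
      rw [hmdef, ← G.sum_degrees_eq_twice_card_edges]
      simp
    exact_mod_cast this
  have hfin := iter h le_rfl
  rw [htot] at hfin
  have hexp : Real.exp (5 * L / h / 2) ≤ 1 + 5 * L / h := by
    set x := 5 * L / h with hx
    have h1 := Real.add_one_le_exp (-(x / 2))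
    have h2 : Real.exp (x / 2) * Real.exp (-(x / 2)) = 1 := by
      rw [← Real.exp_add]; simp
    have h3 := Real.exp_pos (x / 2)
    have h4 : Real.exp (x / 2) * (1 - x / 2) ≤ 1 := by
      rw [← h2]; exact mul_le_mul_of_nonneg_left (by linarith) h3.le
    have h5 : 1 ≤ (1 + x) * (1 - x / 2) := by nlinarith
    exact le_of_mul_le_mul_right (h4.trans h5) (by linarith)
  have hpow : Real.exp (5 * L / 2) ≤ (1 + 5 * L / h) ^ h := by
    have := pow_le_pow_left₀ (Real.exp_pos _).le hexp h
    rw [← Real.exp_nat_mul] at this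
    rwa [show (h : ℝ) * (5 * L / h / 2) = 5 * L / 2 by field_simp] at this
  have hgt : Real.exp L < Real.exp (5 * L / 2) := Real.exp_lt_exp.2 (by linarith)
  rw [hL, Real.exp_log (by linarith), ← hL] at hgt
  have hp0 : 0 < (1 + 5 * L / h) ^ h := by positivity
  nlinarith
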